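/- Minimality of the model L²-optimal extension of a holomorphic jet (model Ohsawa–Takegoshi for jets): fix integers 0 ≤ m ≤ n, k ∈ ℕ, a multi-index β ∈ ℕ^{n−m} with |β| = k, and a polynomial q on ℂ^m. Let f : ℂⁿ → ℂ be holomorphic (complex Fréchet differentiable on all of ℂⁿ) with ∫_{ℂⁿ} |f(z)|² exp(−π|z|²) dV(z) < ∞, and suppose that for every z_Y ∈ ℂ^m the holomorphic function z_N ↦ f(z_Y, z_N) − q(z_Y)·z_N^β on ℂ^{n−m} has all derivatives of order ≤ k vanishing at z_N = 0. Then ∫_{ℂⁿ} |f(z)|² exp(−π|z|²) dV(z) ≥ ∫_{ℂⁿ} |q(z_Y)|² · |z_N^β|² · exp(−π|z|²) dV(z) = (β!/π^k) · ∫_{ℂ^m} |q(z_Y)|² exp(−π|z_Y|²) dV(z_Y). -/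

import Mathlib

open MeasureTheory
open scoped Real

/-- The circle average of an entire function against `w ↦ w⁻¹ ^ k` is its `k`-th Taylor
coefficient at the origin. -/
theorem intervalIntegral_circleMap_inv_pow_mul {φ : ℂ → ℂ} (hφ : Differentiable ℂ φ) (k : ℕ) :
    ∫ θ in (0 : ℝ)..2 * π, (circleMap 0 1 θ)⁻¹ ^ k * φ (circleMap 0 1 θ) =
      2 * π / k.factorial * iteratedDeriv k φ 0 := by
  have h := hφ.differentiableOn.circleIntegral_one_div_sub_center_pow_smul (R := 1) (c := 0)
    one_pos k
  rw [circleIntegral] at h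
  have h2 : ∀ θ : ℝ, deriv (circleMap 0 1) θ •
      ((1 / (circleMap 0 1 θ - 0) ^ (k + 1)) • φ (circleMap 0 1 θ)) =
        Complex.I * ((circleMap 0 1 θ)⁻¹ ^ k * φ (circleMap 0 1 θ)) := by
    intro θ
    have h0 : circleMap 0 1 θ ≠ 0 := circleMap_ne_center one_ne_zero
    simp only [deriv_circleMap, smul_eq_mul, sub_zero]
    field_simp
    rw [pow_succ', one_div, inv_pow]
    field_simp
  simp_rw [h2, intervalIntegral.integral_const_mul] at h
  rw [smul_eq_mul] at h
  apply mul_left_cancel₀ Complex.I_ne_zero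
  rw [h]
  ring

section Smooth

variable {E : Type*} [NormedAddCommGroup E] [NormedSpace ℂ E]

theorem Differentiable.intervalIntegral_circleMap_inv_mul_add_smul {f : E → ℂ}
    (hf : Differentiable ℂ f) (x v : E) :
    ∫ θ in (0 : ℝ)..2 * π, (circleMap 0 1 θ)⁻¹ * f (x + circleMap 0 1 θ • v) =
      2 * π * fderiv ℂ f x v := by
  have h := intervalIntegral_circleMap_inv_pow_mul (φ := fun l : ℂ => f (x + l • v))
    (by fun_prop) 1
  have hd : HasDerivAt (fun l : ℂ => f (x + l • v)) (fderiv ℂ f x v) 0 :=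
    (hf x).hasFDerivAt.hasLineDerivAt v
  simpa [iteratedDeriv_one, hd.deriv] using h

theorem Differentiable.norm_fderiv_le_of_forall_mem_closedBall {f : E → ℂ}
    (hf : Differentiable ℂ f) {x : E} {M : ℝ}
    (hM : ∀ y ∈ Metric.closedBall x 1, ‖f y‖ ≤ M) : ‖fderiv ℂ f x‖ ≤ M := by
  have hM0 : 0 ≤ M := (norm_nonneg _).trans (hM x (Metric.mem_closedBall_self zero_le_one))
  refine ContinuousLinearMap.opNorm_le_of_unit_norm hM0 fun v hv => ?_
  have hd : HasDerivAt (fun l : ℂ => f (x + l • v)) (fderiv ℂ f x v) 0 :=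
    (hf x).hasFDerivAt.hasLineDerivAt v
  have hdiff : Differentiable ℂ (fun l : ℂ => f (x + l • v)) := by fun_prop
  have := Complex.norm_deriv_le_of_forall_mem_sphere_norm_le (c := 0) (C := M) one_pos
    hdiff.diffContOnCl (fun z hz => hM _ (by
      have hz1 : ‖z‖ = 1 := by simpa using hz
      simp [norm_smul, hv, hz1]))
  simpa [hd.deriv] using this

variable [FiniteDimensional ℂ E]

theorem Differentiable.differentiable_fderiv_apply {f : E → ℂ} (hf : Differentiable ℂ f) (v : E) :
    Differentiable ℂ (fun x => fderiv ℂ f x v) := by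
  intro x₀
  borelize E
  have : ProperSpace E := FiniteDimensional.proper ℂ E
  have : ProperSpace (E →L[ℂ] ℂ) := FiniteDimensional.proper ℂ _
  obtain ⟨M, hM⟩ := (isCompact_closedBall x₀ (‖v‖ + 2)).exists_bound_of_continuousOn
    hf.continuous.continuousOn
  have key : HasFDerivAt
      (fun x => ∫ θ in (0 : ℝ)..2 * π, (circleMap 0 1 θ)⁻¹ * f (x + circleMap 0 1 θ • v))
      (∫ θ in (0 : ℝ)..2 * π,
        (circleMap 0 1 θ)⁻¹ • fderiv ℂ f (x₀ + circleMap 0 1 θ • v)) x₀ := by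
    have hc : ∀ x : E, Continuous fun θ : ℝ =>
        (circleMap 0 1 θ)⁻¹ * f (x + circleMap 0 1 θ • v) := fun x => by
      have h1 : Continuous fun θ : ℝ => x + circleMap 0 1 θ • v :=
        continuous_const.add ((continuous_circleMap 0 1).smul continuous_const)
      exact ((continuous_circleMap 0 1).inv₀ fun θ => circleMap_ne_center one_ne_zero).mul
        (hf.continuous.comp h1)
    refine intervalIntegral.hasFDerivAt_integral_of_dominated_of_fderiv_le
      (F' := fun x θ => (circleMap 0 1 θ)⁻¹ • fderiv ℂ f (x + circleMap 0 1 θ • v))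
      (bound := fun _ => M) (Metric.ball_mem_nhds x₀ one_pos)
      (Filter.Eventually.of_forall fun x => (hc x).aestronglyMeasurable)
      ((hc x₀).intervalIntegrable _ _) ?_ ?_ (by simp) ?_
    · have h1 : Continuous fun θ : ℝ => x₀ + circleMap 0 1 θ • v :=
        continuous_const.add ((continuous_circleMap 0 1).smul continuous_const)
      have h2 : Continuous fun θ : ℝ => (circleMap 0 1 θ)⁻¹ :=
        (continuous_circleMap 0 1).inv₀ fun θ => circleMap_ne_center one_ne_zero
      exact h2.aestronglyMeasurable.smul
        ((measurable_fderiv ℂ f).comp h1.measurable).aestronglyMeasurable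
    · refine Filter.Eventually.of_forall fun θ _ x hx => ?_
      rw [norm_smul, norm_inv, norm_circleMap_zero, abs_one, inv_one, one_mul]
      refine hf.norm_fderiv_le_of_forall_mem_closedBall fun y hy => hM y ?_
      rw [mem_ball_iff_norm] at hx
      rw [mem_closedBall_iff_norm] at hy ⊢
      have : y - x₀ = (y - (x + circleMap 0 1 θ • v)) + (x - x₀) + circleMap 0 1 θ • v := by
        abel
      have h3 : ‖circleMap 0 1 θ • v‖ = ‖v‖ := by simp [norm_smul]
      rw [this]
      linarith [norm_add₃_le (a := y - (x + circleMap 0 1 θ • v)) (b := x - x₀)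
        (c := circleMap 0 1 θ • v)]
    · refine Filter.Eventually.of_forall fun θ _ x _ => ?_
      exact ((hasFDerivAt_comp_add_right _).2 (hf _).hasFDerivAt).const_smul
        (circleMap 0 1 θ)⁻¹
  simp only [hf.intervalIntegral_circleMap_inv_mul_add_smul] at key
  have h2 : (2 * π : ℂ) ≠ 0 := by simp [Real.pi_ne_zero]
  have := key.differentiableAt.const_mul (2 * π : ℂ)⁻¹
  simpa [← mul_assoc, h2, Real.pi_ne_zero] using this

/-- An entire function on a finite-dimensional complex space is smooth. -/
theorem Differentiable.contDiff_nat_of_finiteDimensional {f : E → ℂ} (hf : Differentiable ℂ f)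
    (n : ℕ) : ContDiff ℂ n f := by
  induction n generalizing f with
  | zero => exact contDiff_zero.2 hf.continuous
  | succ n ih =>
    push_cast
    exact contDiff_succ_iff_fderiv_apply.2
      ⟨hf, fun h => absurd h (by simp), fun v => ih (hf.differentiable_fderiv_apply v)⟩

theorem intervalIntegral_circleMap_inv_pow_mul_smul_eq_zero {h : E → ℂ} (hh : Differentiable ℂ h)
    {k : ℕ} (h0 : iteratedFDeriv ℂ k h 0 = 0) (w : E) :
    ∫ θ in (0 : ℝ)..2 * π, (circleMap 0 1 θ)⁻¹ ^ k * h (circleMap 0 1 θ • w) = 0 := by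
  rw [intervalIntegral_circleMap_inv_pow_mul (φ := fun l : ℂ => h (l • w)) (by fun_prop) k]
  have := (ContinuousLinearMap.toSpanSingleton ℂ w).iteratedFDeriv_comp_right
    (hh.contDiff_nat_of_finiteDimensional k) 0 le_rfl
  have hw : (fun l : ℂ => h (l • w)) = h ∘ ContinuousLinearMap.toSpanSingleton ℂ w := by
    ext l; simp
  rw [hw, iteratedDeriv_eq_iteratedFDeriv, this, map_zero, h0]
  simp

end Smooth

theorem MeasureTheory.integral_eq_zero_of_intervalIntegral_comp_eq_zero {X : Type*}
    [MeasurableSpace X] {μ : Measure X} [SFinite μ] {F : X → ℂ} {R : ℝ → X → X} {a b : ℝ}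
    (hab : a < b) (hR : ∀ θ, MeasurePreserving (R θ) μ μ)
    (hmeas : AEStronglyMeasurable (fun p : ℝ × X => F (R p.1 p.2))
      ((volume.restrict (Set.Ioc a b)).prod μ))
    (hF : Integrable F μ) (h0 : ∀ x, ∫ θ in a..b, F (R θ x) = 0) : ∫ x, F x ∂μ = 0 := by
  have hcomp : ∀ θ, ∫ x, F (R θ x) ∂μ = ∫ x, F x ∂μ := fun θ => by
    have := integral_map (hR θ).measurable.aemeasurable (f := F)
      ((hR θ).map_eq.symm ▸ hF.aestronglyMeasurable)
    rw [← this, (hR θ).map_eq]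
  have hnorm : ∀ θ, ∫ x, ‖F (R θ x)‖ ∂μ = ∫ x, ‖F x‖ ∂μ := fun θ => by
    have := integral_map (hR θ).measurable.aemeasurable (f := fun x => ‖F x‖)
      ((hR θ).map_eq.symm ▸ hF.norm.aestronglyMeasurable)
    rw [← this, (hR θ).map_eq]
  have hint : Integrable (Function.uncurry fun (θ : ℝ) (x : X) => F (R θ x))
      ((volume.restrict (Set.Ioc a b)).prod μ) := by
    refine (integrable_prod_iff hmeas).2 ⟨Filter.Eventually.of_forall fun θ =>
      (hR θ).integrable_comp_of_integrable hF, ?_⟩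
    simp only [hnorm]
    exact integrable_const _
  have hswap := integral_integral_swap hint
  simp only [hcomp, ← intervalIntegral.integral_of_le hab.le, h0, integral_zero,
    intervalIntegral.integral_const] at hswap
  have hba : (b : ℂ) - a ≠ 0 := sub_ne_zero.2 (by exact_mod_cast hab.ne')
  simpa [hba] using hswap

theorem MeasureTheory.integral_norm_sq_mul_le_of_integral_mul_conj_eq_zero {X : Type*}
    [MeasurableSpace X] {μ : Measure X} {f P : X → ℂ} {e : X → ℝ} (he : ∀ x, 0 ≤ e x)
    (hfm : AEStronglyMeasurable f μ) (hPm : AEStronglyMeasurable P μ)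
    (hem : AEStronglyMeasurable e μ)
    (hf : Integrable (fun x => ‖f x‖ ^ 2 * e x) μ)
    (h0 : Integrable (fun x => (f x - P x) * starRingEnd ℂ (P x) * e x) μ →
      ∫ x, (f x - P x) * starRingEnd ℂ (P x) * e x ∂μ = 0) :
    ∫ x, ‖P x‖ ^ 2 * e x ∂μ ≤ ∫ x, ‖f x‖ ^ 2 * e x ∂μ := by
  by_cases hP : Integrable (fun x => ‖P x‖ ^ 2 * e x) μ
  swap
  · rw [integral_undef hP]
    exact integral_nonneg fun x => mul_nonneg (sq_nonneg _) (he x)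
  have hint : Integrable (fun x => (f x - P x) * starRingEnd ℂ (P x) * e x) μ := by
    refine (hf.add (hP.const_mul 2)).mono' ?_ (Filter.Eventually.of_forall fun x => ?_)
    · exact ((hfm.sub hPm).mul (Complex.continuous_conj.comp_aestronglyMeasurable hPm)).mul
        (Complex.continuous_ofReal.comp_aestronglyMeasurable hem)
    · simp only [norm_mul, RCLike.norm_conj, Complex.norm_real, Real.norm_eq_abs,
        abs_of_nonneg (he x), Pi.add_apply]
      have := norm_sub_le (f x) (P x)
      have h3 : ‖f x - P x‖ * ‖P x‖ ≤ ‖f x‖ ^ 2 + 2 * ‖P x‖ ^ 2 := by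
        nlinarith [norm_nonneg (P x), norm_nonneg (f x), sq_nonneg (‖f x‖ - ‖P x‖)]
      nlinarith [he x, mul_le_mul_of_nonneg_right h3 (he x)]
  have hre : ∫ x, ((f x - P x) * starRingEnd ℂ (P x) * e x).re ∂μ = 0 := by
    have := integral_re (𝕜 := ℂ) hint
    simp only [RCLike.re_to_complex] at this
    rw [this, h0 hint, Complex.zero_re]
  have hadd := integral_add hP (hint.re.const_mul 2)
  simp only [RCLike.re_to_complex, integral_const_mul, hre, mul_zero, add_zero] at hadd
  rw [← hadd]
  refine integral_mono (hP.add (hint.re.const_mul 2)) hf fun x => ?_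
  simp only [Complex.re_mul_ofReal]
  rw [← mul_assoc, ← add_mul]
  refine mul_le_mul_of_nonneg_right ?_ (he x)
  rw [← Complex.normSq_eq_norm_sq, ← Complex.normSq_eq_norm_sq, Complex.normSq_apply,
    Complex.normSq_apply]
  simp only [Complex.mul_re, Complex.sub_re, Complex.sub_im, Complex.conj_re, Complex.conj_im]
  nlinarith [sq_nonneg ((f x).re - (P x).re), sq_nonneg ((f x).im - (P x).im)]

theorem integral_norm_pow_sq_mul_exp_neg_pi (b : ℕ) :
    ∫ z : ℂ, ‖z ^ b‖ ^ 2 * Real.exp (-π * ‖z‖ ^ 2) = b.factorial / π ^ b := by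
  have h := Complex.integral_rpow_mul_exp_neg_mul_rpow (p := 2) (q := 2 * b) (b := π)
    one_le_two (by have : (0 : ℝ) ≤ b := b.cast_nonneg
                   linarith) Real.pi_pos
  have h1 : ((2 * b + 2) / 2 : ℝ) = b + 1 := by ring
  have h2 : (-(2 * b + 2) / 2 : ℝ) = -((b + 1 : ℕ) : ℝ) := by push_cast; ring
  rw [h1, h2, Real.Gamma_nat_eq_factorial, Real.rpow_neg Real.pi_pos.le, Real.rpow_natCast] at h
  have h3 : ∀ z : ℂ, ‖z ^ b‖ ^ 2 * Real.exp (-π * ‖z‖ ^ 2) =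
      ‖z‖ ^ (2 * b : ℝ) * Real.exp (-π * ‖z‖ ^ (2 : ℝ)) := by
    intro z
    rw [norm_pow, ← pow_mul, mul_comm b 2]
    norm_cast
  simp only [h3, h]
  have := Real.pi_ne_zero
  field_simp
  ring

theorem continuous_finAppend_circleMap_smul (m d : ℕ) :
    Continuous fun p : ℝ × (Fin (m + d) → ℂ) =>
      (Fin.append (fun i => p.2 (Fin.castAdd d i))
        (circleMap 0 1 p.1 • fun t => p.2 (Fin.natAdd m t)) : Fin (m + d) → ℂ) := by
  have hc : Continuous fun p : ℝ × (Fin (m + d) → ℂ) => circleMap 0 1 p.1 :=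
    (continuous_circleMap 0 1).comp continuous_fst
  refine continuous_pi fun i => ?_
  refine Fin.addCases (fun i => ?_) (fun t => ?_) i
  · simp only [Fin.append_left]
    fun_prop
  · simp only [Fin.append_right, Pi.smul_apply, smul_eq_mul]
    fun_prop

/-- Multiplying the last `d` coordinates by a unimodular number preserves Lebesgue measure. -/
theorem measurePreserving_finAppend_circleMap_smul (m d : ℕ) (θ : ℝ) :
    MeasurePreserving fun z : Fin (m + d) → ℂ =>
      (Fin.append (fun i => z (Fin.castAdd d i))
        (circleMap 0 1 θ • fun t => z (Fin.natAdd m t)) : Fin (m + d) → ℂ) := by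
  have h := volume_preserving_pi (α' := fun _ : Fin (m + d) => ℂ) (β' := fun _ => ℂ)
    (f := fun i => rotation
      ((Fin.append (fun _ => 1) (fun _ => Circle.exp θ) : Fin (m + d) → Circle) i))
    fun i => LinearIsometryEquiv.measurePreserving _
  convert! h using 2 with z
  ext i
  refine Fin.addCases (fun i => ?_) (fun t => ?_) i
  · simp
  · simp [circleMap]

theorem Differentiable.comp_finAppend {m d : ℕ} {f : (Fin (m + d) → ℂ) → ℂ}
    (hf : Differentiable ℂ f) (zY : Fin m → ℂ) :
    Differentiable ℂ fun zN : Fin d → ℂ => f (Fin.append zY zN) := by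
  refine hf.comp (differentiable_pi.2 fun i => ?_)
  refine Fin.addCases (fun i => ?_) (fun t => ?_) i
  · simp
  · simp only [Fin.append_right]
    fun_prop

/-- Fubini for a product of functions of the first `m` and the last `d` coordinates. -/
theorem integral_mul_castAdd_natAdd {m d : ℕ} (F : (Fin m → ℂ) → ℝ) (G : (Fin d → ℂ) → ℝ) :
    ∫ z : Fin (m + d) → ℂ, F (fun i => z (Fin.castAdd d i)) * G (fun t => z (Fin.natAdd m t)) =
      (∫ x, F x) * ∫ y, G y := by
  have h1 := (volume_measurePreserving_piCongrLeft (fun _ : Fin (m + d) => ℂ)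
    (finSumFinEquiv (m := m) (n := d)))
  have h2 := volume_measurePreserving_sumPiEquivProdPi_symm (fun _ : Fin m ⊕ Fin d => ℂ)
  rw [← integral_prod_mul, ← h1.integral_comp', ← h2.integral_comp']
  refine integral_congr_ae (Filter.Eventually.of_forall fun p => ?_)
  have hl : ∀ (q : (Fin m ⊕ Fin d) → ℂ) (j : Fin m ⊕ Fin d),
      MeasurableEquiv.piCongrLeft (fun _ : Fin (m + d) => ℂ) finSumFinEquiv q
        (finSumFinEquiv j) = q j := fun q j => MeasurableEquiv.piCongrLeft_apply_apply _ _ _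
  have ha : ∀ (q : (Fin m ⊕ Fin d) → ℂ) (i : Fin m),
      MeasurableEquiv.piCongrLeft (fun _ : Fin (m + d) => ℂ) finSumFinEquiv q
        (Fin.castAdd d i) = q (Sum.inl i) := fun q i => hl q (Sum.inl i)
  have hb : ∀ (q : (Fin m ⊕ Fin d) → ℂ) (i : Fin d),
      MeasurableEquiv.piCongrLeft (fun _ : Fin (m + d) => ℂ) finSumFinEquiv q
        (Fin.natAdd m i) = q (Sum.inr i) := fun q i => hl q (Sum.inr i)
  simp only [ha, hb]
  rfl

theorem integral_norm_prod_pow_sq_mul_exp_neg_pi {d : ℕ} (β : Fin d → ℕ) :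
    ∫ w : Fin d → ℂ, ‖∏ t, w t ^ β t‖ ^ 2 * Real.exp (-π * ∑ t, ‖w t‖ ^ 2) =
      ((∏ t, (β t).factorial : ℕ) : ℝ) / π ^ (∑ t, β t) := by
  have h : ∀ w : Fin d → ℂ, ‖∏ t, w t ^ β t‖ ^ 2 * Real.exp (-π * ∑ t, ‖w t‖ ^ 2) =
      ∏ t, (‖w t ^ β t‖ ^ 2 * Real.exp (-π * ‖w t‖ ^ 2)) := fun w => by
    rw [Finset.prod_mul_distrib, norm_prod, Finset.prod_pow, Finset.mul_sum, Real.exp_sum]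
  simp_rw [h]
  rw [integral_fintype_prod_volume_eq_prod
    (fun t (x : ℂ) => ‖x ^ β t‖ ^ 2 * Real.exp (-π * ‖x‖ ^ 2))]
  simp only [integral_norm_pow_sq_mul_exp_neg_pi, Finset.prod_div_distrib,
    Finset.prod_pow_eq_pow_sum, Nat.cast_prod]

theorem statement15 (m d k : ℕ) (β : Fin d → ℕ) (hβ : ∑ j, β j = k)
    (Q : MvPolynomial (Fin m) ℂ) (f : (Fin (m + d) → ℂ) → ℂ)
    (hf : Differentiable ℂ f)
    (hL2 : Integrable (fun z : Fin (m + d) → ℂ =>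
      ‖f z‖ ^ 2 * Real.exp (-π * ∑ i, ‖z i‖ ^ 2)) volume)
    (hjet : ∀ zY : Fin m → ℂ, ∀ j ≤ k,
      iteratedFDeriv ℂ j
        (fun zN : Fin d → ℂ =>
          f (Fin.append zY zN) - MvPolynomial.eval zY Q * ∏ t, zN t ^ β t)
        0 = 0) :
    (∫ z : Fin (m + d) → ℂ, ‖f z‖ ^ 2 * Real.exp (-π * ∑ i, ‖z i‖ ^ 2)) ≥
      (∫ z : Fin (m + d) → ℂ,
        ‖MvPolynomial.eval (fun i => z (Fin.castAdd d i)) Q‖ ^ 2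
          * ‖∏ t, z (Fin.natAdd m t) ^ β t‖ ^ 2
          * Real.exp (-π * ∑ i, ‖z i‖ ^ 2)) ∧
    (∫ z : Fin (m + d) → ℂ,
        ‖MvPolynomial.eval (fun i => z (Fin.castAdd d i)) Q‖ ^ 2
          * ‖∏ t, z (Fin.natAdd m t) ^ β t‖ ^ 2
          * Real.exp (-π * ∑ i, ‖z i‖ ^ 2)) =
      ((∏ t, (β t).factorial : ℕ) : ℝ) / π ^ k
        * ∫ zY : Fin m → ℂ,
            ‖MvPolynomial.eval zY Q‖ ^ 2 * Real.exp (-π * ∑ i, ‖zY i‖ ^ 2) := by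
  constructor
  · set P : (Fin (m + d) → ℂ) → ℂ := fun z =>
      MvPolynomial.eval (fun i => z (Fin.castAdd d i)) Q * ∏ t, z (Fin.natAdd m t) ^ β t with hP
    set e : (Fin (m + d) → ℂ) → ℝ := fun z => Real.exp (-π * ∑ i, ‖z i‖ ^ 2) with he
    have hPc : Continuous P := by
      refine Continuous.mul ((MvPolynomial.continuous_eval Q).comp ?_) ?_ <;> fun_prop
    have hec : Continuous e := by fun_prop
    have hfc : Continuous f := hf.continuous
    have hmain := integral_norm_sq_mul_le_of_integral_mul_conj_eq_zero (μ := volume)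
      (f := f) (P := P) (e := e) (fun z => (Real.exp_pos _).le) hfc.aestronglyMeasurable
      hPc.aestronglyMeasurable hec.aestronglyMeasurable hL2 fun hint => by
        refine integral_eq_zero_of_intervalIntegral_comp_eq_zero (a := 0) (b := 2 * π)
          Real.two_pi_pos (measurePreserving_finAppend_circleMap_smul m d) ?_ hint fun z => ?_
        · have hFc : Continuous fun z => (f z - P z) * starRingEnd ℂ (P z) * (e z : ℂ) :=
            ((hfc.sub hPc).mul (Complex.continuous_conj.comp hPc)).mul
              (Complex.continuous_ofReal.comp hec)
          exact (hFc.comp (continuous_finAppend_circleMap_smul m d)).aestronglyMeasurable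
        · have hdiff : Differentiable ℂ fun zN : Fin d → ℂ =>
              f (Fin.append (fun i => z (Fin.castAdd d i)) zN) -
                MvPolynomial.eval (fun i => z (Fin.castAdd d i)) Q * ∏ t, zN t ^ β t := by
            refine (hf.comp_finAppend _).sub (Differentiable.const_mul ?_ _)
            fun_prop
          have h0 := intervalIntegral_circleMap_inv_pow_mul_smul_eq_zero hdiff
            (hjet _ k le_rfl) (fun t => z (Fin.natAdd m t))
          have hcongr : ∀ θ : ℝ, ∀ y : Fin (m + d) → ℂ,
              y = Fin.append (fun i => z (Fin.castAdd d i))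
                (circleMap 0 1 θ • fun t => z (Fin.natAdd m t)) →
              (f y - P y) * starRingEnd ℂ (P y) * (e y : ℂ) =
              (circleMap 0 1 θ)⁻¹ ^ k *
                (f (Fin.append (fun i => z (Fin.castAdd d i))
                    (circleMap 0 1 θ • fun t => z (Fin.natAdd m t))) -
                  MvPolynomial.eval (fun i => z (Fin.castAdd d i)) Q *
                    ∏ t, (circleMap 0 1 θ • fun t => z (Fin.natAdd m t)) t ^ β t) *
                (starRingEnd ℂ (P z) * (e z : ℂ)) := by
            rintro θ y rfl
            have hconj : starRingEnd ℂ (circleMap 0 1 θ) = (circleMap 0 1 θ)⁻¹ := by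
              rw [Complex.inv_def, Complex.normSq_eq_norm_sq]
              simp
            simp only [hP, he, Fin.append_left, Fin.append_right, Fin.sum_univ_add,
              Pi.smul_apply, smul_eq_mul, norm_mul, norm_circleMap_zero, abs_one, one_mul,
              mul_pow, Finset.prod_mul_distrib, Finset.prod_pow_eq_pow_sum, hβ, map_mul,
              map_pow, hconj]
            ring
          simp only [fun θ => hcongr θ _ rfl]
          rw [intervalIntegral.integral_mul_const, h0, zero_mul]
    simp only [hP, norm_mul, mul_pow] at hmain
    exact hmain
  · have hsplit : ∀ z : Fin (m + d) → ℂ,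
        ‖MvPolynomial.eval (fun i => z (Fin.castAdd d i)) Q‖ ^ 2
          * ‖∏ t, z (Fin.natAdd m t) ^ β t‖ ^ 2 * Real.exp (-π * ∑ i, ‖z i‖ ^ 2) =
        (‖MvPolynomial.eval (fun i => z (Fin.castAdd d i)) Q‖ ^ 2 *
          Real.exp (-π * ∑ i, ‖z (Fin.castAdd d i)‖ ^ 2)) *
        (‖∏ t, z (Fin.natAdd m t) ^ β t‖ ^ 2 *
          Real.exp (-π * ∑ t, ‖z (Fin.natAdd m t)‖ ^ 2)) := fun z => by
      rw [Fin.sum_univ_add, mul_add, Real.exp_add]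
      ring
    simp_rw [hsplit]
    rw [integral_mul_castAdd_natAdd
      (fun x => ‖MvPolynomial.eval x Q‖ ^ 2 * Real.exp (-π * ∑ i, ‖x i‖ ^ 2))
      (fun w => ‖∏ t, w t ^ β t‖ ^ 2 * Real.exp (-π * ∑ t, ‖w t‖ ^ 2)),
      integral_norm_prod_pow_sq_mul_exp_neg_pi, hβ, mul_comm]
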